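/- arXiv:2107.12498 — 4 statements merged into one kernel-verified Lean document; each statement's English description precedes it below -/
import Mathlib

section
/- A complete separable metric space X without isolated points does not admit a topologically ergodic non-singular map. That is, for every non-singular map f : X → X there exists a set U ⊆ X with f⁻¹(U) = U that is neither meager nor residual. -/
open Filter Topology Set

/-- Two points are equivalent when their forward orbits under `f` eventually merge. The invariant
sets of `f` are exactly the unions of equivalence classes. -/
def orbitSetoid {X : Type*} (f : X → X) : Setoid X where
  r x y := ∃ m n : ℕ, f^[m] x = f^[n] y
  iseqv :=
    { refl := fun _ => ⟨0, 0, rfl⟩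
      symm := fun ⟨m, n, h⟩ => ⟨n, m, h.symm⟩
      trans := by
        rintro x y z ⟨m, n, h⟩ ⟨p, q, h'⟩
        refine ⟨p + m, n + q, ?_⟩
        rw [Function.iterate_add_apply, h, ← Function.iterate_add_apply, Nat.add_comm p n,
          Function.iterate_add_apply, h', ← Function.iterate_add_apply] }

theorem isMeagre_singleton_of_neBot {X : Type*} [TopologicalSpace X] [T1Space X] (x : X)
    [(𝓝[≠] x).NeBot] : IsMeagre ({x} : Set X) :=
  residual_of_dense_open isClosed_singleton.isOpen_compl (dense_compl_singleton x)

theorem isMeagre_preimage_iterate {X : Type*} [TopologicalSpace X] {f : X → X}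
    (hns : ∀ M : Set X, IsMeagre M → IsMeagre (f ⁻¹' M)) (m : ℕ) {M : Set X} (hM : IsMeagre M) :
    IsMeagre (f^[m] ⁻¹' M) := by
  induction m with
  | zero => simpa using hM
  | succ m ih =>
    rw [Function.iterate_succ, preimage_comp]
    exact hns _ ih

theorem isMeagre_orbitSetoid_class {X : Type*} [TopologicalSpace X] [T1Space X]
    (hperfect : ∀ x : X, (𝓝[≠] x).NeBot) {f : X → X}
    (hns : ∀ M : Set X, IsMeagre M → IsMeagre (f ⁻¹' M)) (x : X) :
    IsMeagre {y | (orbitSetoid f).r y x} := by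
  have h : {y | (orbitSetoid f).r y x} = ⋃ m : ℕ, ⋃ n : ℕ, f^[m] ⁻¹' {f^[n] x} := by
    ext y
    simp only [mem_iUnion, mem_preimage, mem_singleton_iff]
    rfl
  rw [h]
  refine isMeagre_iUnion fun m => isMeagre_iUnion fun n => ?_
  have := hperfect (f^[n] x)
  exact isMeagre_preimage_iterate hns m (isMeagre_singleton_of_neBot _)

/-- **Proposition.** A (nonempty) complete separable metric space without isolated
points does not admit a topologically ergodic non-singular map: every non-singular map
`f` has an invariant set `U` (`f ⁻¹' U = U`) that is neither meager nor residual. -/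
theorem statement4 {X : Type*} [MetricSpace X] [CompleteSpace X]
    [TopologicalSpace.SeparableSpace X] [Nonempty X]
    (hperfect : ∀ x : X, (𝓝[≠] x).NeBot)
    (f : X → X)
    (hns : ∀ M : Set X, IsMeagre M → IsMeagre (f ⁻¹' M)) :
    ∃ U : Set X, f ⁻¹' U = U ∧ ¬ IsMeagre U ∧ ¬ IsMeagre Uᶜ := by
  by_contra! hergodic
  have : SecondCountableTopology X := UniformSpace.secondCountable_of_separable X
  let r : X → X := fun x => (Quotient.mk (orbitSetoid f) x).out
  have hrf : ∀ x, r (f x) = r x := fun x =>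
    congrArg Quotient.out (Quotient.sound (s := orbitSetoid f) ⟨0, 1, rfl⟩)
  have hr_rel : ∀ {x y}, r x = r y → (orbitSetoid f).r x y := fun h =>
    Quotient.exact (Quotient.out_injective h)
  -- almost every point lies on the residual side of each invariant set `r ⁻¹' B`
  have hside : ∀ B ∈ TopologicalSpace.countableBasis X,
      ∀ᶠ x in residual X, (r x ∈ B ↔ ¬ IsMeagre (r ⁻¹' B)) := by
    intro B _
    have hinv : f ⁻¹' (r ⁻¹' B) = r ⁻¹' B := by
      ext x
      simp only [mem_preimage, hrf]
    by_cases hB : IsMeagre (r ⁻¹' B)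
    · filter_upwards [hB] with x hx
      exact iff_of_false hx (not_not_intro hB)
    · have hBc : (r ⁻¹' B)ᶜᶜ ∈ residual X := hergodic _ hinv hB
      filter_upwards [hBc] with x hx
      exact iff_of_true (not_not.mp hx) hB
  have hall := (eventually_countable_ball (TopologicalSpace.countable_countableBasis X)).2 hside
  obtain ⟨x, hx⟩ := (dense_of_mem_residual hall).nonempty
  have hclass := isMeagre_orbitSetoid_class hperfect hns x
  have hcompl : {y | (orbitSetoid f).r y x}ᶜ ∈ residual X := hclass
  obtain ⟨y, hy, hyx⟩ := (dense_of_mem_residual (inter_mem hall hcompl)).nonempty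
  refine hyx (hr_rel ?_)
  exact (TopologicalSpace.isBasis_countableBasis X).eq_iff.2 fun B hB =>
    (hy B hB).trans (hx B hB).symm
end

section
/- Let X be a Baire topological space, Y a complete separable metric space, and φ : X → Y a Baire measurable map. Then the image-support of φ, defined as Im supp φ = {y ∈ Y : φ⁻¹(B_ε(y)) is not meager for every ε > 0}, is nonempty. -/
open Filter Topology Set

/-- `s` has the Baire property: it differs from an open set by a meager set. -/
def BaireSet {X : Type*} [TopologicalSpace X] (s : Set X) : Prop :=
  ∃ u : Set X, IsOpen u ∧ IsMeagre (symmDiff s u)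

/-- **Lemma.** If `X` is a (nonempty) Baire space, `Y` a complete separable metric
space and `φ : X → Y` is Baire measurable, then the image-support of `φ` — the set of
`y ∈ Y` such that `φ ⁻¹' (B_ε y)` is non-meager for every `ε > 0` — is nonempty. -/
theorem statement8 {X : Type*} [TopologicalSpace X] [BaireSpace X] [Nonempty X]
    {Y : Type*} [MetricSpace Y] [CompleteSpace Y] [TopologicalSpace.SeparableSpace Y]
    (φ : X → Y) (hφ : ∀ V : Set Y, IsOpen V → BaireSet (φ ⁻¹' V)) :
    {y : Y | ∀ ε : ℝ, 0 < ε → ¬ IsMeagre (φ ⁻¹' Metric.ball y ε)}.Nonempty := by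
  by_contra hempty
  have hmeagre (y : Y) : ∃ ε : ℝ, 0 < ε ∧ IsMeagre (φ ⁻¹' Metric.ball y ε) := by
    by_contra! hy
    exact hempty ⟨y, hy⟩
  choose ε hε hball using hmeagre
  have := UniformSpace.secondCountable_of_separable Y
  obtain ⟨s, hs, hcover⟩ := TopologicalSpace.countable_cover_nhds
    fun y ↦ Metric.ball_mem_nhds y (hε y)
  refine not_isMeagre_of_isOpen isOpen_univ (univ_nonempty (α := X)) ?_
  rw [← preimage_univ (f := φ), ← hcover, preimage_iUnion₂]
  exact isMeagre_biUnion hs fun y _ ↦ hball y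
end

section
/- Let X be a compact metric space, X₀ an open and dense subset of X, and f : X₀ → X a continuous non-singular map. If U ⊆ X is a fat (non-meager) almost invariant set, i.e. the symmetric difference f⁻¹(U) Δ U is meager, then U' := ⋃_{n≥0} f⁻ⁿ(⋂_{j≥0} f⁻ʲ(U)) is a fat set with f⁻¹(U') = U' and the symmetric difference U' Δ U is meager. -/
open Filter Topology Set

/-- The preimage of `V` under the map `f` restricted to the domain `X₀`:
`f⁻¹(V) = {x ∈ X₀ : f x ∈ V}`. -/
def preIn {X : Type*} (f : X → X) (X₀ : Set X) (V : Set X) : Set X :=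
  {x | x ∈ X₀ ∧ f x ∈ V}

theorem preIn_mono {X : Type*} (f : X → X) (X₀ : Set X) : Monotone (preIn f X₀) :=
  fun _ _ h _ hx => ⟨hx.1, h hx.2⟩

theorem preIn_iUnion {X : Type*} {ι : Sort*} (f : X → X) (X₀ : Set X) (V : ι → Set X) :
    preIn f X₀ (⋃ i, V i) = ⋃ i, preIn f X₀ (V i) := by
  ext x
  simp [preIn]

theorem preIn_symmDiff {X : Type*} (f : X → X) (X₀ A B : Set X) :
    preIn f X₀ (symmDiff A B) = symmDiff (preIn f X₀ A) (preIn f X₀ B) := by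
  ext x
  simp only [preIn, mem_symmDiff, mem_ofPred_eq]
  tauto

/-- The set of points of `U` whose whole orbit stays in `U` is forward invariant. -/
theorem iInter_iterate_subset_preIn {X : Type*} (f : X → X) (X₀ U : Set X) :
    ⋂ j : ℕ, (preIn f X₀)^[j] U ⊆ preIn f X₀ (⋂ j : ℕ, (preIn f X₀)^[j] U) := by
  intro x hx
  have hsucc (j : ℕ) : x ∈ preIn f X₀ ((preIn f X₀)^[j] U) := by
    rw [← Function.iterate_succ_apply' (preIn f X₀)]
    exact mem_iInter.1 hx (j + 1)
  exact ⟨(hsucc 0).1, mem_iInter.2 fun j => (hsucc j).2⟩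

theorem preIn_iUnion_iterate_eq {X : Type*} (f : X → X) (X₀ V : Set X)
    (hV : V ⊆ preIn f X₀ V) :
    preIn f X₀ (⋃ n : ℕ, (preIn f X₀)^[n] V) = ⋃ n : ℕ, (preIn f X₀)^[n] V := by
  simp_rw [preIn_iUnion, ← Function.iterate_succ_apply' (preIn f X₀)]
  refine Subset.antisymm (iUnion_subset fun n => subset_iUnion_of_subset (n + 1) Subset.rfl)
    (iUnion_subset fun n => subset_iUnion_of_subset n ?_)
  rw [Function.iterate_succ_apply]
  exact (preIn_mono f X₀).iterate n hV

theorem isMeagre_symmDiff_iterate_preIn {X : Type*} [TopologicalSpace X] {f : X → X}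
    {X₀ U : Set X} (hns : ∀ M : Set X, IsMeagre M → IsMeagre (preIn f X₀ M))
    (hai : IsMeagre (symmDiff (preIn f X₀ U) U)) (n : ℕ) :
    IsMeagre (symmDiff ((preIn f X₀)^[n] U) U) := by
  induction n with
  | zero => simp [IsMeagre.empty]
  | succ n ih =>
    rw [Function.iterate_succ_apply']
    have h := hns _ ih
    rw [preIn_symmDiff] at h
    exact (h.union hai).mono (symmDiff_triangle _ _ _)

theorem symmDiff_iUnion_iterate_subset {X : Type*} (f : X → X) (X₀ U : Set X) :
    symmDiff (⋃ n : ℕ, (preIn f X₀)^[n] (⋂ j : ℕ, (preIn f X₀)^[j] U)) U ⊆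
      ⋃ n : ℕ, symmDiff ((preIn f X₀)^[n] U) U := by
  rintro x (⟨hx, hxU⟩ | ⟨hxU, hx⟩)
  · obtain ⟨n, hn⟩ := mem_iUnion.1 hx
    exact mem_iUnion.2 ⟨n, Or.inl ⟨(preIn_mono f X₀).iterate n (iInter_subset _ 0) hn, hxU⟩⟩
  · have hxV : x ∉ ⋂ j : ℕ, (preIn f X₀)^[j] U := fun h => hx (mem_iUnion.2 ⟨0, h⟩)
    obtain ⟨j, hj⟩ := not_forall.1 (mt mem_iInter.2 hxV)
    exact mem_iUnion.2 ⟨j, Or.inr ⟨hxU, hj⟩⟩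

/-- **Lemma.** Let `X` be a compact metric space, `X₀` an open dense subset and
`f : X₀ → X` continuous and non-singular. If `U` is a fat almost invariant set
(`f⁻¹(U) Δ U` meager), then `U' = ⋃ₙ f⁻ⁿ(⋂ⱼ f⁻ʲ(U))` is a fat invariant set with
`U' Δ U` meager. -/
theorem statement11 {X : Type*} [MetricSpace X] [CompactSpace X]
    (X₀ : Set X) (hopen : IsOpen X₀) (hdense : Dense X₀)
    (f : X → X) (hf : ContinuousOn f X₀)
    (hns : ∀ M : Set X, IsMeagre M → IsMeagre (preIn f X₀ M))
    (U : Set X) (hfat : ¬ IsMeagre U)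
    (hai : IsMeagre (symmDiff (preIn f X₀ U) U)) :
    ¬ IsMeagre (⋃ n : ℕ, (preIn f X₀)^[n] (⋂ j : ℕ, (preIn f X₀)^[j] U)) ∧
    preIn f X₀ (⋃ n : ℕ, (preIn f X₀)^[n] (⋂ j : ℕ, (preIn f X₀)^[j] U)) =
      ⋃ n : ℕ, (preIn f X₀)^[n] (⋂ j : ℕ, (preIn f X₀)^[j] U) ∧
    IsMeagre (symmDiff
      (⋃ n : ℕ, (preIn f X₀)^[n] (⋂ j : ℕ, (preIn f X₀)^[j] U)) U) := by
  have hdiff : IsMeagre (symmDiff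
      (⋃ n : ℕ, (preIn f X₀)^[n] (⋂ j : ℕ, (preIn f X₀)^[j] U)) U) :=
    (isMeagre_iUnion (isMeagre_symmDiff_iterate_preIn hns hai)).mono
      (symmDiff_iUnion_iterate_subset f X₀ U)
  refine ⟨fun h => hfat ((h.union hdiff).mono fun x hx => ?_),
    preIn_iUnion_iterate_eq f X₀ _ (iInter_iterate_subset_preIn f X₀ U), hdiff⟩
  by_cases hx' : x ∈ ⋃ n : ℕ, (preIn f X₀)^[n] (⋂ j : ℕ, (preIn f X₀)^[j] U)
  · exact Or.inl hx'
  · exact Or.inr (Or.inr ⟨hx, hx'⟩)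
end

section
/- Let X be a separable metric Baire space and f : X → X a continuous map, and set X₀ = {x ∈ X : the closure of W_f^s(x) equals X}. Then, generically on X, the statistical spectrum satisfies 𝕳_f(x) ⊇ {μ ∈ M¹(f) : β_f(μ) ∩ X₀ ≠ ∅}; in particular 𝕳_f(x) contains every ergodic f-invariant Borel probability measure μ for which X₀ has positive outer μ-measure. -/
open Filter Topology Set MeasureTheory

section Defs

variable {X : Type*} [MetricSpace X] [MeasurableSpace X]

/-- The set of `f`-invariant Borel probability measures. -/
def invProb (f : X → X) : Set (Measure X) :=
  {μ | IsProbabilityMeasure μ ∧ μ.map f = μ}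

/-- `x` lies in the basin of `μ`: the empirical measures along the orbit of `x`
converge to `μ` in the weak* topology (tested against bounded continuous functions). -/
def InBasinOfMeasure (f : X → X) (μ : Measure X) (x : X) : Prop :=
  ∀ g : BoundedContinuousFunction X ℝ,
    Tendsto (fun n : ℕ => (∑ j ∈ Finset.range n, g (f^[j] x)) / (n : ℝ)) atTop
      (𝓝 (∫ y, g y ∂μ))

/-- `μ` belongs to the statistical spectrum of `x`: it is an accumulation point of the
empirical measures along the orbit of `x` in the weak* topology. -/
def InSpectrum (f : X → X) (μ : Measure X) (x : X) : Prop :=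
  ∃ φ : ℕ → ℕ, StrictMono φ ∧ ∀ g : BoundedContinuousFunction X ℝ,
    Tendsto (fun k : ℕ => (∑ j ∈ Finset.range (φ k), g (f^[j] x)) / ((φ k : ℕ) : ℝ))
      atTop (𝓝 (∫ y, g y ∂μ))

/-- The stable set of a point `p`. -/
def stableSet (f : X → X) (p : X) : Set X :=
  {x | Tendsto (fun n : ℕ => dist (f^[n] x) (f^[n] p)) atTop (𝓝 0)}

end Defs

section BirkhoffCluster

variable {X ι : Type*}

/-- The Birkhoff averages of a family of observables, as a vector indexed by the family. -/
noncomputable def birkhoffVector (f : X → X) (h : ι → X → ℝ) (n : ℕ) (x : X) : ι → ℝ :=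
  fun i => birkhoffAverage ℝ f (h i) n x

theorem tendsto_birkhoffAverage_sub_of_mem_stableSet [MetricSpace X] {f : X → X} {g : X → ℝ}
    (hg : UniformContinuous g) {y z : X} (hy : y ∈ stableSet f z) :
    Tendsto (fun n => birkhoffAverage ℝ f g n y - birkhoffAverage ℝ f g n z) atTop (𝓝 0) := by
  have hyz : Tendsto (fun n => (f^[n] y, f^[n] z)) atTop (uniformity X) :=
    tendsto_uniformity_iff_dist_tendsto_zero.2 hy
  have hd : Tendsto (fun n => g (f^[n] y) - g (f^[n] z)) atTop (𝓝 0) := by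
    have := tendsto_uniformity_iff_dist_tendsto_zero.1 (Tendsto.comp hg hyz)
    exact tendsto_zero_iff_norm_tendsto_zero.2 (by simpa [Real.dist_eq] using this)
  refine hd.cesaro.congr fun n => ?_
  simp [birkhoffAverage, birkhoffSum, Finset.sum_sub_distrib, mul_sub]

theorem mapClusterPt_birkhoffVector_of_mem_stableSet [MetricSpace X] {f : X → X} {h : ι → X → ℝ}
    (hh : ∀ i, UniformContinuous (h i)) {y z : X} (hy : y ∈ stableSet f z) {c : ι → ℝ}
    (hc : MapClusterPt c atTop (birkhoffVector f h · z)) :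
    MapClusterPt c atTop (birkhoffVector f h · y) := by
  have hd : Tendsto (fun n => birkhoffVector f h n y - birkhoffVector f h n z) atTop (𝓝 0) :=
    tendsto_pi_nhds.2 fun i => tendsto_birkhoffAverage_sub_of_mem_stableSet (hh i) hy
  obtain ⟨l, hl⟩ := mapClusterPt_iff_ultrafilter.1 hc
  refine mapClusterPt_iff_ultrafilter.2 ⟨l, hl.1, ?_⟩
  simpa using (hd.mono_left hl.1).add hl.2

theorem continuous_birkhoffVector [TopologicalSpace X] {f : X → X} (hf : Continuous f)
    {h : ι → X → ℝ} (hh : ∀ i, Continuous (h i)) (n : ℕ) :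
    Continuous (birkhoffVector f h n) := by
  refine continuous_pi fun i => ?_
  have hsum : Continuous fun x => ∑ j ∈ Finset.range n, h i (f^[j] x) :=
    continuous_finsetSum _ fun j _ => (hh i).comp (hf.iterate j)
  exact hsum.const_smul (n : ℝ)⁻¹

/-- Generically, the Birkhoff averages accumulate at every vector at which the averages of some
point with dense stable set accumulate. -/
theorem isMeagre_not_forall_mapClusterPt_birkhoffVector [MetricSpace X] [Countable ι] {f : X → X}
    (hf : Continuous f) {h : ι → X → ℝ} (hh : ∀ i, UniformContinuous (h i)) :
    IsMeagre {x | ¬ ∀ (c : ι → ℝ) (z : X), closure (stableSet f z) = univ →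
      MapClusterPt c atTop (birkhoffVector f h · z) →
      MapClusterPt c atTop (birkhoffVector f h · x)} := by
  let D : Set (ι → ℝ) := {c | ∃ z, closure (stableSet f z) = univ ∧
    MapClusterPt c atTop (birkhoffVector f h · z)}
  let 𝓑 := {B ∈ TopologicalSpace.countableBasis (ι → ℝ) | (B ∩ D).Nonempty}
  have h𝓑 : 𝓑.Countable := (TopologicalSpace.countable_countableBasis _).mono (sep_subset _ _)
  let U : Set (ι → ℝ) → ℕ → Set X := fun B N => ⋃ n ≥ N, birkhoffVector f h n ⁻¹' B
  have hU : ∀ B ∈ 𝓑, ∀ N, U B N ∈ residual X := by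
    intro B hB N
    have hBo := TopologicalSpace.isOpen_of_mem_countableBasis hB.1
    refine residual_of_dense_open (isOpen_biUnion fun n _ =>
      hBo.preimage (continuous_birkhoffVector hf (fun i => (hh i).continuous) n)) ?_
    obtain ⟨c, hcB, z, hz, hc⟩ := hB.2
    refine (dense_iff_closure_eq.2 hz).mono fun y hy => ?_
    obtain ⟨n, hn, hnB⟩ := frequently_atTop.1 ((mapClusterPt_birkhoffVector_of_mem_stableSet hh hy
      hc).frequently (hBo.mem_nhds hcB)) N
    exact mem_biUnion hn hnB
  have hR : (⋂ B ∈ 𝓑, ⋂ N, U B N) ∈ residual X :=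
    (countable_bInter_mem h𝓑).2 fun B hB => countable_iInter_mem.2 (hU B hB)
  refine mem_of_superset hR fun x hx => ?_
  simp only [mem_compl_iff, mem_ofPred_eq, not_not]
  intro c z hz hc
  refine (TopologicalSpace.isBasis_countableBasis (ι → ℝ)).nhds_hasBasis.mapClusterPt_iff_frequently.2
    fun B hB => frequently_atTop.2 fun N => ?_
  simpa [U] using mem_iInter.1 (mem_iInter₂.1 hx B ⟨hB.1, c, hB.2, z, hz, hc⟩) N

end BirkhoffCluster

section MeanErgodic

variable {X ι : Type*} [MeasurableSpace X] {μ : Measure X} {f : X → X}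

theorem coeFn_birkhoffAverage_compMeasurePreserving (hf : MeasurePreserving f μ μ) {g : X → ℝ}
    (hg : MemLp g 2 μ) (n : ℕ) :
    (birkhoffAverage ℝ (Lp.compMeasurePreserving f hf) id n (hg.toLp g) : Lp ℝ 2 μ) =ᵐ[μ]
      birkhoffAverage ℝ f g n := by
  have hiter : ∀ j, (((Lp.compMeasurePreserving f hf)^[j] (hg.toLp g) : Lp ℝ 2 μ) : X → ℝ) =ᵐ[μ]
      g ∘ f^[j] := by
    intro j
    induction j with
    | zero => exact hg.coeFn_toLp
    | succ j ih =>
      rw [Function.iterate_succ_apply', Function.iterate_succ, ← Function.comp_assoc]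
      exact (Lp.coeFn_compMeasurePreserving _ hf).trans
        (hf.quasiMeasurePreserving.ae_eq_comp ih)
  have hsum : ∀ s : Finset ℕ,
      ((∑ j ∈ s, (Lp.compMeasurePreserving f hf)^[j] (hg.toLp g) : Lp ℝ 2 μ) : X → ℝ) =ᵐ[μ]
        fun x => ∑ j ∈ s, g (f^[j] x) := by
    intro s
    induction s using Finset.cons_induction with
    | empty => exact Lp.coeFn_zero ℝ 2 μ
    | cons a s ha ih =>
      simp only [Finset.sum_cons]
      filter_upwards [Lp.coeFn_add ((Lp.compMeasurePreserving f hf)^[a] (hg.toLp g))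
        (∑ j ∈ s, (Lp.compMeasurePreserving f hf)^[j] (hg.toLp g)), ih, hiter a] with x h1 h2 h3
      rw [h1, Pi.add_apply, h2, h3, Function.comp_apply]
  filter_upwards [Lp.coeFn_smul (n : ℝ)⁻¹
    (∑ j ∈ Finset.range n, (Lp.compMeasurePreserving f hf)^[j] (hg.toLp g)),
    hsum (Finset.range n)] with x h1 h2
  simp only [birkhoffAverage, birkhoffSum, id]
  rw [h1, Pi.smul_apply, h2]

/-- **Mean ergodic theorem** for an ergodic map, with convergence in measure. -/
theorem Ergodic.tendstoInMeasure_birkhoffAverage [IsProbabilityMeasure μ] (hf : Ergodic f μ)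
    {g : X → ℝ} (hg : MemLp g 2 μ) :
    TendstoInMeasure μ (fun n => birkhoffAverage ℝ f g n) atTop (fun _ => ∫ y, g y ∂μ) := by
  have hmp := hf.toMeasurePreserving
  let T : Lp ℝ 2 μ →L[ℝ] Lp ℝ 2 μ := (Lp.compMeasurePreservingₗᵢ ℝ f hmp).toContinuousLinearMap
  have hT : ∀ u, T u = Lp.compMeasurePreserving f hmp u := fun _ => rfl
  have hlim := T.tendsto_birkhoffAverage_orthogonalProjection
    (LinearIsometry.norm_toContinuousLinearMap_le _) (hg.toLp g)
  set S := T.eqLocus (1 : Lp ℝ 2 μ →L[ℝ] Lp ℝ 2 μ)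
  set P : S := S.orthogonalProjectionOnto (hg.toLp g)
  have hPinv : (P : Lp ℝ 2 μ) ∘ f =ᵐ[μ] (P : Lp ℝ 2 μ) := by
    have : T P = P := P.2
    rw [hT] at this
    exact (Lp.coeFn_compMeasurePreserving _ hmp).symm.trans (by rw [this])
  obtain ⟨c, hc⟩ := hf.ae_eq_const_of_ae_eq_comp_ae (Lp.aestronglyMeasurable _) hPinv
  have hone : MemLp (fun _ : X => (1 : ℝ)) 2 μ := memLp_const 1
  have honeS : hone.toLp ∈ S := by
    change T _ = _
    rw [hT]
    refine Lp.ext ((Lp.coeFn_compMeasurePreserving _ hmp).trans ?_)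
    filter_upwards [hmp.quasiMeasurePreserving.ae_eq_comp hone.coeFn_toLp, hone.coeFn_toLp]
      with x h1 h2
    rw [h1]
    exact h2.symm
  have hinner : ∀ u : Lp ℝ 2 μ, inner ℝ hone.toLp u = ∫ y, u y ∂μ := by
    intro u
    rw [L2.inner_def]
    refine integral_congr_ae ?_
    filter_upwards [hone.coeFn_toLp] with x hx
    rw [hx]
    simp
  have hcg : c = ∫ y, g y ∂μ := by
    have h1 : inner ℝ hone.toLp (hg.toLp g) = inner ℝ hone.toLp (P : Lp ℝ 2 μ) := by
      have := S.inner_orthogonalProjectionOnto_eq_of_mem_left ⟨_, honeS⟩ (hg.toLp g)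
      exact this.symm
    rw [hinner, hinner, integral_congr_ae hg.coeFn_toLp, integral_congr_ae hc] at h1
    simpa using h1.symm
  exact (tendstoInMeasure_of_tendsto_Lp hlim).congr
    (fun n => coeFn_birkhoffAverage_compMeasurePreserving hmp hg n)
    (hc.trans (by rw [hcg]; rfl))

/-- For an ergodic measure, almost every orbit has Birkhoff averages accumulating at the vector of
space averages of a countable family of square-integrable observables. -/
theorem Ergodic.ae_mapClusterPt_birkhoffVector [IsProbabilityMeasure μ] [Countable ι]
    (hf : Ergodic f μ) {h : ι → X → ℝ} (hh : ∀ i, MemLp (h i) 2 μ) :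
    ∀ᵐ x ∂μ, MapClusterPt (fun i => ∫ y, h i y ∂μ) atTop (birkhoffVector f h · x) := by
  set c : ι → ℝ := fun i => ∫ y, h i y ∂μ
  have hnear : ∀ V ∈ 𝓝 c, Tendsto (fun n => μ {x | birkhoffVector f h n x ∉ V}) atTop (𝓝 0) := by
    intro V hV
    rw [nhds_pi, Filter.mem_pi] at hV
    obtain ⟨I, hI, t, ht, htV⟩ := hV
    choose ε hε hεt using fun i => Metric.mem_nhds_iff.1 (ht i)
    have hlim : Tendsto (fun n => ∑ i ∈ hI.toFinset,
        μ {x | ε i ≤ dist (birkhoffAverage ℝ f (h i) n x) (c i)}) atTop (𝓝 0) := by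
      simpa using tendsto_finsetSum hI.toFinset fun i _ =>
        tendstoInMeasure_iff_dist.1 (hf.tendstoInMeasure_birkhoffAverage (hh i)) (ε i) (hε i)
    refine tendsto_of_tendsto_of_tendsto_of_le_of_le tendsto_const_nhds hlim
      (fun n => zero_le) fun n => ?_
    refine (measure_mono fun x hx => ?_).trans (measure_biUnion_finset_le hI.toFinset _)
    by_contra hcon
    simp only [Finite.mem_toFinset, mem_iUnion, mem_ofPred_eq, exists_prop, not_exists, not_and,
      not_le] at hcon
    exact hx (htV fun i hi => hεt i (hcon i hi))
  obtain ⟨V, hV⟩ := (𝓝 c).exists_antitone_basis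
  have hae : ∀ k N, ∀ᵐ x ∂μ, ∃ n ≥ N, birkhoffVector f h n x ∈ V k := by
    intro k N
    rw [ae_iff]
    refine le_antisymm (ge_of_tendsto (hnear _ (hV.mem k)) ?_) zero_le
    filter_upwards [eventually_ge_atTop N] with n hn
    refine measure_mono fun x hx hxV => hx ⟨n, hn, hxV⟩
  filter_upwards [ae_all_iff.2 fun k => ae_all_iff.2 (hae k)] with x hx
  exact hV.toHasBasis.mapClusterPt_iff_frequently.2 fun k _ => frequently_atTop.2 (hx k)

end MeanErgodic

section BallObservable

variable {X : Type*} [MetricSpace X] [TopologicalSpace.SeparableSpace X] [Nonempty X]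

/-- A nonnegative Lipschitz function whose support is the ball of radius `1 / (p.2 + 1)` around the
point of index `p.1` of a dense sequence. -/
noncomputable def ballBump (p : ℕ × ℕ) (x : X) : ℝ :=
  max 0 (1 / ((p.2 : ℝ) + 1) - dist x (TopologicalSpace.denseSeq X p.1))

/-- A countable family of uniformly continuous functions with values in `[0, 1]` whose integrals
determine weak convergence of probability measures. -/
noncomputable def ballObservable (q : Finset (ℕ × ℕ) × ℕ) (x : X) : ℝ :=
  min 1 ((q.2 : ℝ) * ∑ p ∈ q.1, ballBump p x)

theorem ballBump_nonneg (p : ℕ × ℕ) (x : X) : 0 ≤ ballBump p x := le_max_left _ _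

theorem ballBump_pos_iff {p : ℕ × ℕ} {x : X} : 0 < ballBump p x ↔
    x ∈ Metric.ball (TopologicalSpace.denseSeq X p.1) (1 / ((p.2 : ℝ) + 1)) := by
  simp [ballBump]

theorem uniformContinuous_ballBump (p : ℕ × ℕ) : UniformContinuous (ballBump (X := X) p) :=
  (LipschitzWith.id.const_max 0).uniformContinuous.comp (uniformContinuous_const.sub
    (uniformContinuous_id.dist uniformContinuous_const))

theorem uniformContinuous_ballObservable (q : Finset (ℕ × ℕ) × ℕ) :
    UniformContinuous (ballObservable (X := X) q) := by
  have hsum : ∀ s : Finset (ℕ × ℕ), UniformContinuous fun x : X => ∑ p ∈ s, ballBump p x := by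
    intro s
    induction s using Finset.cons_induction with
    | empty => simpa using uniformContinuous_const
    | cons a s ha ih =>
      simp only [Finset.sum_cons]
      exact (uniformContinuous_ballBump a).add ih
  exact (LipschitzWith.id.const_min 1).uniformContinuous.comp ((hsum q.1).const_smul (q.2 : ℝ))

theorem ballObservable_nonneg (q : Finset (ℕ × ℕ) × ℕ) (x : X) : 0 ≤ ballObservable q x :=
  le_min zero_le_one (mul_nonneg (Nat.cast_nonneg _)
    (Finset.sum_nonneg fun p _ => ballBump_nonneg p x))

theorem ballObservable_le_one (q : Finset (ℕ × ℕ) × ℕ) (x : X) : ballObservable q x ≤ 1 :=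
  min_le_left _ _

theorem norm_ballObservable_le_one (q : Finset (ℕ × ℕ) × ℕ) (x : X) :
    ‖ballObservable q x‖ ≤ 1 := by
  rw [Real.norm_of_nonneg (ballObservable_nonneg q x)]
  exact ballObservable_le_one q x

theorem exists_ballBump_pos {G : Set X} (hG : IsOpen G) {x : X} (hx : x ∈ G) :
    ∃ p : ℕ × ℕ, 0 < ballBump p x ∧ ∀ y : X, 0 < ballBump p y → y ∈ G := by
  obtain ⟨r, hr, hrG⟩ := Metric.isOpen_iff.1 hG x hx
  obtain ⟨l, hl⟩ := exists_nat_one_div_lt (half_pos hr)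
  obtain ⟨i, hi⟩ := (TopologicalSpace.denseRange_denseSeq X).exists_dist_lt x
    (Nat.one_div_pos_of_nat (α := ℝ) (n := l))
  refine ⟨(i, l), ballBump_pos_iff.2 hi, fun y hy => hrG ?_⟩
  have hy' := ballBump_pos_iff.1 hy
  rw [Metric.mem_ball] at hy' ⊢
  have := dist_triangle_right y x (TopologicalSpace.denseSeq X i)
  simp only at hy' hi
  linarith

/-- The indicator of an open set is a pointwise limit from below of members of the family
`ballObservable`. -/
theorem exists_tendsto_ballObservable_indicator {G : Set X} (hG : IsOpen G) :
    ∃ w : ℕ → Finset (ℕ × ℕ) × ℕ,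
      (∀ m x, ballObservable (w m) x ≤ G.indicator (fun _ => (1 : ℝ)) x) ∧
      ∀ x, Tendsto (fun m => ballObservable (w m) x) atTop
        (𝓝 (G.indicator (fun _ => (1 : ℝ)) x)) := by
  classical
  let s : ℕ → Finset (ℕ × ℕ) := fun m =>
    (Finset.range m ×ˢ Finset.range m).filter fun p => ∀ y : X, 0 < ballBump p y → y ∈ G
  have hout : ∀ m, ∀ x ∉ G, ballObservable (s m, m) x = 0 := by
    intro m x hx
    have : ∑ p ∈ s m, ballBump p x = 0 := Finset.sum_eq_zero fun p hp =>
      le_antisymm (not_lt.1 fun hpos => hx ((Finset.mem_filter.1 hp).2 x hpos))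
        (ballBump_nonneg p x)
    simp [ballObservable, this]
  refine ⟨fun m => (s m, m), fun m x => ?_, fun x => ?_⟩
  · by_cases hx : x ∈ G
    · simpa [hx] using ballObservable_le_one _ x
    · simp [hx, hout]
  · by_cases hx : x ∈ G
    · obtain ⟨p, hp, hpG⟩ := exists_ballBump_pos hG hx
      obtain ⟨k, hk⟩ := exists_nat_gt (1 / ballBump p x)
      rw [indicator_of_mem hx]
      refine tendsto_const_nhds.congr' ?_
      filter_upwards [eventually_ge_atTop k, eventually_gt_atTop (max p.1 p.2)] with m hmk hmp
      refine (min_eq_left ?_).symm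
      have hps : p ∈ s m := Finset.mem_filter.2 ⟨Finset.mem_product.2
        ⟨Finset.mem_range.2 ((le_max_left _ _).trans_lt hmp),
          Finset.mem_range.2 ((le_max_right _ _).trans_lt hmp)⟩, hpG⟩
      calc (1 : ℝ) ≤ k * ballBump p x := ((div_lt_iff₀ hp).1 hk).le
        _ ≤ m * ∑ p ∈ s m, ballBump p x := by
          gcongr
          exact Finset.single_le_sum (f := fun p => ballBump p x)
            (fun p _ => ballBump_nonneg p x) hps
    · simp [hx, hout]

variable [MeasurableSpace X] [BorelSpace X]

theorem integrable_ballObservable (μ : Measure X) [IsFiniteMeasure μ]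
    (q : Finset (ℕ × ℕ) × ℕ) : Integrable (ballObservable (X := X) q) μ :=
  .of_bound (uniformContinuous_ballObservable q).continuous.aestronglyMeasurable 1
    (.of_forall (norm_ballObservable_le_one q))

theorem memLp_ballObservable (μ : Measure X) [IsFiniteMeasure μ] (q : Finset (ℕ × ℕ) × ℕ) :
    MemLp (ballObservable (X := X) q) 2 μ :=
  .of_bound (uniformContinuous_ballObservable q).continuous.aestronglyMeasurable 1
    (.of_forall (norm_ballObservable_le_one q))

theorem tendsto_probabilityMeasure_of_tendsto_integral_ballObservable
    {ν : ℕ → ProbabilityMeasure X} {μ : ProbabilityMeasure X}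
    (h : ∀ q, Tendsto (fun k => ∫ y, ballObservable q y ∂(ν k : Measure X)) atTop
      (𝓝 (∫ y, ballObservable q y ∂(μ : Measure X)))) :
    Tendsto ν atTop (𝓝 μ) := by
  refine tendsto_of_forall_isOpen_le_liminf' fun G hG => ?_
  obtain ⟨w, hwG, hw⟩ := exists_tendsto_ballObservable_indicator hG
  have hle : ∀ (ρ : ProbabilityMeasure X) m,
      ENNReal.ofReal (∫ y, ballObservable (w m) y ∂(ρ : Measure X)) ≤ (ρ : Measure X) G := by
    intro ρ m
    have h1 := integral_mono (integrable_ballObservable (ρ : Measure X) (w m))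
      ((integrable_const (1 : ℝ)).indicator hG.measurableSet) (hwG m)
    rw [integral_indicator_const _ hG.measurableSet] at h1
    exact ENNReal.ofReal_le_of_le_toReal (by simpa [Measure.real] using h1)
  have hlim : Tendsto (fun m => ENNReal.ofReal (∫ y, ballObservable (w m) y ∂(μ : Measure X)))
      atTop (𝓝 ((μ : Measure X) G)) := by
    have h1 : Tendsto (fun m => ∫ y, ballObservable (w m) y ∂(μ : Measure X)) atTop
        (𝓝 (∫ y, G.indicator (fun _ => (1 : ℝ)) y ∂(μ : Measure X))) :=
      tendsto_integral_of_dominated_convergence (fun _ => 1)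
        (fun m => (uniformContinuous_ballObservable (w m)).continuous.aestronglyMeasurable)
        (integrable_const _) (fun m => .of_forall (norm_ballObservable_le_one (w m)))
        (.of_forall hw)
    rw [integral_indicator_const _ hG.measurableSet] at h1
    simpa [Measure.real] using ENNReal.tendsto_ofReal h1
  refine le_of_tendsto' hlim fun m => ?_
  rw [← (ENNReal.tendsto_ofReal (h (w m))).liminf_eq]
  exact liminf_le_liminf (.of_forall fun k => hle (ν k) m)

end BallObservable

section Spectrum

theorem InBasinOfMeasure.mapClusterPt {X ι : Type*} [MetricSpace X] [MeasurableSpace X]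
    {f : X → X} {μ : Measure X} {z : X} (hz : InBasinOfMeasure f μ z) {h : ι → X → ℝ} (hc : ∀ i, Continuous (h i))
    (hb : ∀ i y, ‖h i y‖ ≤ 1) :
    MapClusterPt (fun i => ∫ y, h i y ∂μ) atTop (birkhoffVector f h · z) := by
  refine (tendsto_pi_nhds.2 fun i => ?_).mapClusterPt
  refine (hz (.ofNormedAddCommGroup (h i) (hc i) 1 (hb i))).congr fun n => ?_
  simp [birkhoffVector, birkhoffAverage, birkhoffSum, div_eq_inv_mul]

variable {X : Type*} [MetricSpace X] [MeasurableSpace X] [BorelSpace X]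

/-- The uniform probability measure on the first `n + 1` points of the orbit of `x`. -/
noncomputable def empiricalMeasure (f : X → X) (n : ℕ) (x : X) : Measure X :=
  ((n + 1 : ℕ) : ENNReal)⁻¹ • ∑ j ∈ Finset.range (n + 1), Measure.dirac (f^[j] x)

instance isProbabilityMeasure_empiricalMeasure (f : X → X) (n : ℕ) (x : X) :
    IsProbabilityMeasure (empiricalMeasure f n x) := by
  refine ⟨?_⟩
  simp only [empiricalMeasure, Measure.smul_apply, Measure.finsetSum_apply, measure_univ,
    Finset.sum_const, Finset.card_range, nsmul_eq_mul, mul_one, smul_eq_mul]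
  exact ENNReal.inv_mul_cancel (by simp) (ENNReal.natCast_ne_top _)

theorem integral_empiricalMeasure (f : X → X) (n : ℕ) (x : X) (g : X → ℝ) :
    ∫ y, g y ∂(empiricalMeasure f n x) = birkhoffAverage ℝ f g (n + 1) x := by
  rw [empiricalMeasure, integral_smul_measure,
    integral_finsetSum_measure fun _ _ => integrable_dirac (by simp)]
  simp [birkhoffAverage, birkhoffSum, -Nat.cast_add]

theorem inSpectrum_of_mapClusterPt [TopologicalSpace.SeparableSpace X] [Nonempty X] {f : X → X}
    {μ : Measure X} [IsProbabilityMeasure μ] {x : X}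
    (h : MapClusterPt (fun q => ∫ y, ballObservable q y ∂μ) atTop
      (birkhoffVector f ballObservable · x)) :
    InSpectrum f μ x := by
  obtain ⟨ψ, hψ, hlim⟩ := h.tendsto_subseq
  have hφ : StrictMono fun k => ψ (k + 1) := hψ.comp (strictMono_nat_of_lt_succ fun k => by simp)
  have hpos : ∀ k, ψ (k + 1) - 1 + 1 = ψ (k + 1) := fun k =>
    Nat.sub_add_cancel ((Nat.zero_le _).trans_lt (hψ k.lt_succ_self))
  let ν : ℕ → ProbabilityMeasure X := fun k => ⟨empiricalMeasure f (ψ (k + 1) - 1) x, inferInstance⟩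
  have hν : ∀ (g : X → ℝ) k,
      ∫ y, g y ∂(ν k : Measure X) = birkhoffAverage ℝ f g (ψ (k + 1)) x := by
    intro g k
    rw [← hpos k]
    exact integral_empiricalMeasure f _ x g
  have hconv : Tendsto ν atTop (𝓝 ⟨μ, inferInstance⟩) := by
    refine tendsto_probabilityMeasure_of_tendsto_integral_ballObservable fun q => ?_
    simp only [hν]
    exact (tendsto_pi_nhds.1 hlim q).comp (tendsto_add_atTop_nat 1)
  refine ⟨fun k => ψ (k + 1), hφ, fun g => ?_⟩
  refine (ProbabilityMeasure.tendsto_iff_forall_integral_tendsto.1 hconv g).congr fun k => ?_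
  rw [hν, birkhoffAverage, birkhoffSum, smul_eq_mul, div_eq_inv_mul]

end Spectrum

/-- **Proposition.** Let `X` be a separable metric Baire space, `f : X → X` continuous
and `X₀` the set of points whose stable set is dense. Then, generically on `X`, the
statistical spectrum of `x` contains every invariant probability whose basin meets
`X₀`; in particular it contains every ergodic invariant probability giving `X₀`
positive outer measure. -/
theorem statement17 {X : Type*} [MetricSpace X] [BaireSpace X]
    [TopologicalSpace.SeparableSpace X] [MeasurableSpace X] [BorelSpace X]
    (f : X → X) (hf : Continuous f) :
    IsMeagre {x : X | ¬ ∀ μ : Measure X, μ ∈ invProb f →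
      ({y : X | InBasinOfMeasure f μ y} ∩
        {z : X | closure (stableSet f z) = univ}).Nonempty →
      InSpectrum f μ x} ∧
    IsMeagre {x : X | ¬ ∀ μ : Measure X, μ ∈ invProb f → Ergodic f μ →
      0 < μ {z : X | closure (stableSet f z) = univ} → InSpectrum f μ x} := by
  rcases isEmpty_or_nonempty X with hX | hX
  · exact ⟨by simpa [Set.eq_empty_of_isEmpty] using IsMeagre.empty,
      by simpa [Set.eq_empty_of_isEmpty] using IsMeagre.empty⟩
  have hgen := isMeagre_not_forall_mapClusterPt_birkhoffVector hf
    (uniformContinuous_ballObservable (X := X))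
  constructor
  · refine hgen.mono (ofPred_subset_ofPred.2 fun x => mt fun hcl => ?_)
    rintro μ ⟨hμ, -⟩ ⟨z, hzb, hz⟩
    exact inSpectrum_of_mapClusterPt (hcl _ z hz (hzb.mapClusterPt
      (fun q => (uniformContinuous_ballObservable q).continuous) norm_ballObservable_le_one))
  · refine hgen.mono (ofPred_subset_ofPred.2 fun x => mt fun hcl => ?_)
    rintro μ ⟨hμ, -⟩ herg hpos
    obtain ⟨z, hz, hzc⟩ : ∃ z, closure (stableSet f z) = univ ∧
        MapClusterPt (fun q => ∫ y, ballObservable q y ∂μ) atTop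
          (birkhoffVector f ballObservable · z) := by
      by_contra! hcon
      exact hpos.ne' (measure_mono_null hcon
        (herg.ae_mapClusterPt_birkhoffVector (memLp_ballObservable μ)))
    exact inSpectrum_of_mapClusterPt (hcl _ z hz hzc)
end
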